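/- Let f : [0,1] → [0,1] be a homeomorphism of the unit interval. Then the topological multiplicity Mult(f) equals the number of ergodic f-invariant Borel probability measures on [0,1] (equality in ℕ ∪ {∞}). -/

import Mathlib

open MeasureTheory

/-- Iterates of a homeomorphism, indexed by natural numbers. -/
def hiterN {X : Type*} [TopologicalSpace X] (T : X ≃ₜ X) : ℕ → (X ≃ₜ X)
  | 0 => Homeomorph.refl X
  | n + 1 => (hiterN T n).trans T

/-- Iterates of a homeomorphism, indexed by integers. -/
def hiter {X : Type*} [TopologicalSpace X] (T : X ≃ₜ X) : ℤ → (X ≃ₜ X)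
  | Int.ofNat n => hiterN T n
  | Int.negSucc n => (hiterN T (n + 1)).symm

/-- The set of all iterates `f ∘ Tⁿ` for `f ∈ F` and `n ∈ ℤ`. -/
def iterSet {X : Type*} [TopologicalSpace X] (T : X ≃ₜ X) (F : Set C(X, ℝ)) :
    Set C(X, ℝ) :=
  {h | ∃ f ∈ F, ∃ n : ℤ, h = f.comp (hiter T n : C(X, X))}

/-- The topological multiplicity of `(X, T)`: the minimal cardinality (in `ℕ ∪ {∞}`) of a
finite set `F ⊆ C(X)` whose iterates `f ∘ Tⁿ`, `f ∈ F`, `n ∈ ℤ`, span a dense subspace of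
`C(X)`. -/
noncomputable def topMult {X : Type*} [TopologicalSpace X] (T : X ≃ₜ X) : ℕ∞ :=
  sInf {c : ℕ∞ | ∃ F : Finset C(X, ℝ), (F.card : ℕ∞) = c ∧
    Dense (Submodule.span ℝ (iterSet T (F : Set C(X, ℝ))) : Set C(X, ℝ))}

theorem hiterN_eq {X : Type*} [TopologicalSpace X] (T : X ≃ₜ X) (n : ℕ) : hiterN T n = T ^ n := by
  induction n with
  | zero => rfl
  | succ n ih => rw [pow_succ', ← ih]; rfl

theorem hiter_eq {X : Type*} [TopologicalSpace X] (T : X ≃ₜ X) (n : ℤ) : hiter T n = T ^ n := by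
  cases n with
  | ofNat n => simpa [hiter] using hiterN_eq T n
  | negSucc n => rw [zpow_negSucc, ← hiterN_eq]; rfl

theorem ergodic_mutuallySingular {X : Type*} [MeasurableSpace X] {f : X → X} {μ ν : Measure X}
    [IsProbabilityMeasure μ] [IsProbabilityMeasure ν] (hμ : Ergodic f μ) (hν : Ergodic f ν)
    (hne : ν ≠ μ) : ν.MutuallySingular μ := by
  have hinv := hν.toMeasurePreserving.singularPart hμ.toMeasurePreserving
  have hac : ν.singularPart μ ≪ ν := (Measure.singularPart_le ν μ).absolutelyContinuous
  obtain ⟨c, hc⟩ := hν.eq_smul_of_absolutelyContinuous hinv hac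
  have hs := Measure.mutuallySingular_singularPart ν μ
  rw [hc] at hs
  rcases eq_or_ne c 0 with rfl | h0
  · exfalso
    rw [zero_smul, Measure.singularPart_eq_zero] at hc
    exact hne (hμ.eq_of_absolutelyContinuous hν.toMeasurePreserving hc)
  · exact hs.mono_ac (Measure.absolutelyContinuous_smul h0) Measure.AbsolutelyContinuous.rfl

theorem ergodic_lin_indep {X : Type*} [TopologicalSpace X] [CompactSpace X] [MeasurableSpace X]
    [BorelSpace X] [HasOuterApproxClosed X] {f : X → X} (t : Finset (Measure X))
    (ht : ∀ μ ∈ t, IsProbabilityMeasure μ ∧ Ergodic f μ) (c : Measure X → ℝ)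
    (hc : ∀ φ : C(X, ℝ), ∑ μ ∈ t, c μ * ∫ x, φ x ∂μ = 0) : ∀ μ ∈ t, c μ = 0 := by
  classical
  have key : ∑ μ ∈ t, ENNReal.ofReal (c μ) • μ = ∑ μ ∈ t, ENNReal.ofReal (- c μ) • μ := by
    have hfin : ∀ μ ∈ t, IsFiniteMeasure μ := fun μ hμ => by
      have := (ht μ hμ).1; infer_instance
    have hfin1 : ∀ d : Measure X → ℝ,
        IsFiniteMeasure (∑ μ ∈ t, ENNReal.ofReal (d μ) • μ) := fun d => by
      constructor
      rw [Measure.finsetSum_apply]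
      refine ENNReal.sum_lt_top.2 fun μ hμ => ?_
      have := hfin μ hμ
      rw [Measure.smul_apply, smul_eq_mul]
      exact ENNReal.mul_lt_top ENNReal.ofReal_lt_top (measure_lt_top _ _)
    have hf1 := hfin1 c
    have hf2 := hfin1 (fun μ => - c μ)
    refine ext_of_forall_integral_eq_of_IsFiniteMeasure fun φ => ?_
    have hint : ∀ d : Measure X → ℝ, ∫ x, φ x ∂(∑ μ ∈ t, ENNReal.ofReal (d μ) • μ)
        = ∑ μ ∈ t, max (d μ) 0 * ∫ x, φ x ∂μ := fun d => by
      rw [integral_finsetSum_measure]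
      · refine Finset.sum_congr rfl fun μ hμ => ?_
        rw [integral_smul_measure, ENNReal.toReal_ofReal', smul_eq_mul]
      · intro μ hμ
        have := hfin μ hμ
        exact (φ.integrable μ).smul_measure ENNReal.ofReal_ne_top
    rw [hint, hint, ← sub_eq_zero, ← Finset.sum_sub_distrib]
    refine Eq.trans ?_ (hc φ.toContinuousMap)
    refine Finset.sum_congr rfl fun μ hμ => ?_
    rw [← sub_mul]
    congr 1
    rcases le_total (c μ) 0 with h | h
    · rw [max_eq_right h, max_eq_left (by linarith)]; ring
    · rw [max_eq_left h, max_eq_right (by linarith)]; ring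
  intro μ hμ
  have := (ht μ hμ).1
  have hsing : ∀ ν ∈ t.erase μ, ν.MutuallySingular μ := fun ν hν => by
    have h := Finset.mem_erase.1 hν
    have := (ht ν h.2).1
    exact ergodic_mutuallySingular (ht μ hμ).2 (ht ν h.2).2 h.1
  have hB : ∃ B : Set X, MeasurableSet B ∧ μ B = 1 ∧ ∀ ν ∈ t.erase μ, ν B = 0 := by
    choose! s hs using hsing
    refine ⟨⋂ ν ∈ t.erase μ, s ν, ?_, ?_, ?_⟩
    · exact Finset.measurableSet_biInter _ fun ν hν => (hs ν hν).1
    · rw [prob_compl_eq_zero_iff (Finset.measurableSet_biInter _ fun ν hν => (hs ν hν).1) |>.symm]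
      simp only [Set.compl_iInter]
      exact (measure_biUnion_null_iff (t.erase μ).countable_toSet).2 fun ν hν => (hs ν hν).2.2
    · intro ν hν
      exact measure_mono_null (Set.biInter_subset_of_mem hν) (hs ν hν).2.1
  obtain ⟨B, -, hB1, hB0⟩ := hB
  have hev : ∀ d : Measure X → ℝ, (∑ ν ∈ t, ENNReal.ofReal (d ν) • ν) B = ENNReal.ofReal (d μ) := by
    intro d
    rw [Measure.finsetSum_apply, ← Finset.add_sum_erase _ _ hμ, Finset.sum_eq_zero]
    · simp [hB1]
    · intro ν hν
      simp [hB0 ν hν]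
  have h := congrArg (fun m => m B) key
  simp only [hev] at h
  rcases le_total (c μ) 0 with h0 | h0
  · rw [ENNReal.ofReal_of_nonpos h0] at h
    have := ENNReal.ofReal_eq_zero.1 h.symm
    linarith
  · rw [ENNReal.ofReal_of_nonpos (neg_nonpos.2 h0)] at h
    have := ENNReal.ofReal_eq_zero.1 h
    linarith

theorem zpow_measurePreserving {X : Type*} [TopologicalSpace X] [MeasurableSpace X] [BorelSpace X]
    (f : X ≃ₜ X) (μ : Measure X) (h : MeasurePreserving f μ μ) (n : ℤ) :
    MeasurePreserving (⇑(f ^ n)) μ μ := by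
  have hnat : ∀ n : ℕ, MeasurePreserving (⇑(f ^ n)) μ μ := fun n => by
    induction n with
    | zero => exact MeasurePreserving.id μ
    | succ n ih => rw [pow_succ]; exact ih.comp h
  cases n with
  | ofNat n => simpa using hnat n
  | negSucc n =>
    rw [zpow_negSucc]
    exact MeasurePreserving.symm (f ^ (n+1)).toMeasurableEquiv (hnat (n+1))

theorem encard_le_topMult {X : Type*} [TopologicalSpace X] [CompactSpace X] [MeasurableSpace X]
    [BorelSpace X] [HasOuterApproxClosed X] (f : X ≃ₜ X) :
    {μ : Measure X | IsProbabilityMeasure μ ∧ Ergodic (⇑f) μ}.encard ≤ topMult f := by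
  classical
  refine le_sInf ?_
  rintro _ ⟨F, rfl, hF⟩
  by_contra hlt
  rw [not_le] at hlt
  obtain ⟨t, hts, htc⟩ := Set.exists_subset_encard_eq (Order.add_one_le_of_lt hlt)
  have htfin : t.Finite := Set.finite_of_encard_eq_coe (k := F.card + 1) (by rw [htc]; rfl)
  lift t to Finset (Measure X) using htfin
  rw [Set.encard_coe_eq_coe_finsetCard] at htc
  have htc' : t.card = F.card + 1 := by exact_mod_cast htc
  have hp : ∀ μ : t, IsProbabilityMeasure (μ : Measure X) := fun μ => (hts μ.2).1
  let Φ : C(X, ℝ) →L[ℝ] (t → ℝ) := ContinuousLinearMap.pi fun μ =>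
    LinearMap.mkContinuous
      { toFun := fun φ => ∫ x, φ x ∂(μ : Measure X)
        map_add' := fun φ ψ => by
          have := hp μ
          exact integral_add ((BoundedContinuousFunction.mkOfCompact φ).integrable _)
            ((BoundedContinuousFunction.mkOfCompact ψ).integrable _)
        map_smul' := fun a φ => integral_const_mul a _ } 1 fun φ => by
          have := hp μ
          have := norm_integral_le_of_norm_le_const (μ := (μ : Measure X)) (f := φ) (C := ‖φ‖)
            (Filter.Eventually.of_forall fun x => φ.norm_coe_le_norm x)
          simpa using this
  have hΦ : ∀ φ μ, Φ φ μ = ∫ x, φ x ∂(μ : Measure X) := fun _ _ => rfl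
  have hsurj : LinearMap.range Φ.toLinearMap = ⊤ := by
    by_contra hne
    obtain ⟨g, hg0, hg⟩ := Submodule.exists_le_ker_of_lt_top _ (lt_top_iff_ne_top.2 hne)
    apply hg0
    let c : Measure X → ℝ := fun μ => if h : μ ∈ t then g (Pi.single ⟨μ, h⟩ 1) else 0
    have hc := ergodic_lin_indep (f := f) t (fun μ hμ => hts hμ) c (fun φ => by
      have h1 : g (Φ φ) = 0 := hg ⟨φ, rfl⟩
      rw [LinearMap.pi_apply_eq_sum_univ g (Φ φ)] at h1
      rw [← h1, ← Finset.sum_coe_sort]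
      refine Finset.sum_congr rfl fun μ _ => ?_
      simp only [c, hΦ, smul_eq_mul, μ.2, dif_pos]
      rw [mul_comm]
      congr 2
      ext ν
      simp [Pi.single_apply, eq_comm])
    refine LinearMap.pi_ext' fun μ => ?_
    ext
    have := hc μ μ.2
    simpa [c] using this
  let W : Submodule ℝ (t → ℝ) := Submodule.span ℝ (F.image Φ : Finset (t → ℝ))
  have hW : IsClosed (W : Set (t → ℝ)) := W.closed_of_finiteDimensional
  have hsub : (Submodule.span ℝ (iterSet f (F : Set C(X, ℝ)))) ≤ W.comap Φ.toLinearMap := by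
    rw [Submodule.span_le]
    rintro _ ⟨φ, hφ, n, rfl⟩
    apply Submodule.subset_span
    rw [Finset.coe_image]
    refine ⟨φ, hφ, ?_⟩
    ext μ
    rw [hΦ]
    change _ = ∫ x, (φ.comp (hiter f n : C(X, X))) x ∂(μ : Measure X)
    rw [hiter_eq]
    exact ((zpow_measurePreserving f _ (hts μ.2).2.toMeasurePreserving n).integral_comp
      (f ^ n).measurableEmbedding φ).symm
  have hall : ∀ φ, Φ φ ∈ W := by
    have hcl : IsClosed (Φ ⁻¹' (W : Set (t → ℝ))) := hW.preimage Φ.continuous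
    have hd : Dense (Φ ⁻¹' (W : Set (t → ℝ))) := hF.mono hsub
    intro φ
    have := hcl.closure_eq ▸ hd φ
    exact this
  have htop : W = ⊤ := by
    rw [eq_top_iff, ← hsurj]
    rintro _ ⟨φ, rfl⟩
    exact hall φ
  have h1 : Module.finrank ℝ W ≤ (F.image Φ).card := finrank_span_finset_le_card _
  rw [htop, finrank_top, Module.finrank_pi, Fintype.card_coe] at h1
  have := Finset.card_image_le (s := F) (f := Φ)
  omega

open Filter Topology in
theorem wander_point {α : Type*} [CompleteLinearOrder α] [TopologicalSpace α] [OrderTopology α]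
    (g : α → α) (hg : StrictMono g) (hgc : Continuous g) (K : Set α) (hK : IsClosed K)
    (hfix : ∀ x ∈ K, g x ≠ x) (x : α) (hx : x < g x) :
    ∃ U ∈ 𝓝 x, ∃ N : ℕ, ∀ n ≥ N, ∀ y ∈ U, g^[n] y ∉ K := by
  have hmono : Monotone fun n => g^[n] x :=
    hg.monotone.monotone_iterate_of_le_map hx.le
  obtain ⟨p, hp⟩ : ∃ p, Tendsto (fun n => g^[n] x) atTop (𝓝 p) :=
    ⟨_, tendsto_atTop_iSup hmono⟩
  have hpfix : g p = p := isFixedPt_of_tendsto_iterate hp hgc.continuousAt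
  have hle : ∀ n, g^[n] x ≤ p := fun n => hmono.ge_of_tendsto hp n
  have hxp : x < p := lt_of_lt_of_le hx (hle 1)
  have hpK : p ∉ K := fun h => hfix p h hpfix
  obtain ⟨l, hl, hlK⟩ := exists_Ioc_subset_of_mem_nhds (hK.isOpen_compl.mem_nhds hpK) ⟨x, hxp⟩
  obtain ⟨N, hN⟩ := (hp.eventually (lt_mem_nhds hl)).exists
  have hNm : Tendsto (g^[N]) (𝓝 x) (𝓝 (g^[N] x)) := (hgc.iterate N).continuousAt
  have hev : ∀ᶠ y in 𝓝 x, l < g^[N] y ∧ y < p ∧ y < g y := by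
    refine (hNm.eventually (lt_mem_nhds hN)).and ((gt_mem_nhds hxp).and ?_)
    exact (isOpen_lt continuous_id hgc).mem_nhds hx
  refine ⟨_, hev, N, fun n hn y hy => ?_⟩
  obtain ⟨h1, h2, h3⟩ := hy
  have hmono' : Monotone fun n => g^[n] y :=
    hg.monotone.monotone_iterate_of_le_map h3.le
  refine hlK ⟨lt_of_lt_of_le h1 (hmono' hn), ?_⟩
  have := (hg.monotone.iterate n) h2.le
  rwa [Function.iterate_fixed hpfix] at this

open Filter Topology in
theorem wander_compact {α : Type*} [CompleteLinearOrder α] [TopologicalSpace α] [OrderTopology α]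
    (g : α → α) (hg : StrictMono g) (hgc : Continuous g) (K : Set α) (hK : IsCompact K)
    (hfix : ∀ x ∈ K, g x ≠ x) :
    ∃ N : ℕ, ∀ n ≥ N, ∀ y ∈ K, g^[n] y ∉ K := by
  have h1 : ∀ x ∈ K, ∃ U ∈ 𝓝 x, ∃ N : ℕ, ∀ n ≥ N, ∀ y ∈ U, g^[n] y ∉ K := by
    intro x hx
    rcases lt_or_gt_of_ne (hfix x hx) with h | h
    · exact wander_point (α := αᵒᵈ) g hg.dual hgc K hK.isClosed hfix x h
    · exact wander_point g hg hgc K hK.isClosed hfix x h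
  refine hK.induction_on (p := fun S => ∃ N : ℕ, ∀ n ≥ N, ∀ y ∈ S, g^[n] y ∉ K) ?_ ?_ ?_ ?_
  · exact ⟨0, by simp⟩
  · rintro s t hst ⟨N, hN⟩
    exact ⟨N, fun n hn y hy => hN n hn y (hst hy)⟩
  · rintro s t ⟨N, hN⟩ ⟨M, hM⟩
    refine ⟨max N M, fun n hn y hy => ?_⟩
    rcases hy with hy | hy
    · exact hN n (le_trans (le_max_left _ _) hn) y hy
    · exact hM n (le_trans (le_max_right _ _) hn) y hy
  · intro x hx
    obtain ⟨U, hU, N, hN⟩ := h1 x hx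
    exact ⟨U, mem_nhdsWithin_of_mem_nhds hU, N, hN⟩

theorem wander_interval (f : ↥unitInterval ≃ₜ ↥unitInterval) (K : Set unitInterval)
    (hK : IsCompact K) (hfix : ∀ x ∈ K, f (f x) ≠ x) :
    ∃ N : ℕ, ∀ n : ℤ, (N : ℤ) ≤ |n| → ∀ y ∈ K, (f ^ n) y ∉ K := by
  have hm : StrictMono (fun x => f (f x)) := by
    rcases Continuous.strictMono_of_inj f.continuous f.injective with h | h
    · exact h.comp h
    · exact h.comp h
  have hK' : IsCompact (K ∪ f '' K) := hK.union (hK.image f.continuous)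
  obtain ⟨N, hN⟩ := wander_compact (fun x => f (f x)) hm (f.continuous.comp f.continuous)
    (K ∪ f '' K) hK' (by
      rintro x (hx | ⟨y, hy, rfl⟩)
      · exact hfix x hx
      · intro h
        exact hfix y hy (f.injective h))
  have hit : ∀ n y, (fun x => f (f x))^[n] y = (f ^ (2 * n)) y := by
    intro n y
    induction n with
    | zero => rfl
    | succ n ih =>
      rw [Function.iterate_succ_apply', ih, mul_add, mul_one, add_comm, pow_add]; rfl
  have hnat : ∀ n : ℕ, 2 * N + 1 ≤ n → ∀ y ∈ K, (f ^ n) y ∉ K := by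
    intro n hn y hy hc
    rcases Nat.even_or_odd' n with ⟨k, rfl | rfl⟩
    · refine hN k (by omega) y (Or.inl hy) ?_
      rw [hit]; exact Or.inl hc
    · refine hN k (by omega) (f y) (Or.inr ⟨y, hy, rfl⟩) ?_
      rw [hit]
      rw [pow_succ] at hc
      exact Or.inl hc
  refine ⟨2 * N + 1, fun n hn y hy hc => ?_⟩
  rcases le_total 0 n with h | h
  · lift n to ℕ using h
    rw [zpow_natCast] at hc
    rw [abs_of_nonneg (by positivity)] at hn
    exact hnat n (by omega) y hy hc
  · obtain ⟨m, rfl⟩ : ∃ m : ℕ, n = -m := ⟨n.natAbs, by omega⟩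
    rw [abs_neg, abs_of_nonneg (by positivity)] at hn
    refine hnat m (by omega) _ hc ?_
    have : (f ^ m) ((f ^ (-(m : ℤ))) y) = (f ^ m * f ^ (-(m : ℤ))) y := rfl
    rw [this]
    simpa using hy

theorem sidon_aux {i j i' j' : ℕ} (hij : i < j) (h : (4 : ℤ) ^ j - 4 ^ i = 4 ^ j' - 4 ^ i') :
    j' ≤ j := by
  by_contra hlt
  rw [not_le] at hlt
  have h1 : (4 : ℤ) ^ i < 4 ^ j := pow_lt_pow_right₀ (by norm_num) hij
  have h2 : i' < j' := by
    have : (4 : ℤ) ^ i' < 4 ^ j' := by linarith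
    exact (pow_lt_pow_iff_right₀ (by norm_num)).1 this
  obtain ⟨k, rfl⟩ : ∃ k, j' = k + 1 := ⟨j' - 1, by omega⟩
  have h3 : (4 : ℤ) ^ j ≤ 4 ^ k := pow_le_pow_right₀ (by norm_num) (by omega)
  have h4 : (4 : ℤ) ^ i' ≤ 4 ^ k := pow_le_pow_right₀ (by norm_num) (by omega)
  have h5 : (0 : ℤ) < 4 ^ k := by positivity
  have h6 : (0 : ℤ) < 4 ^ i := by positivity
  rw [pow_succ] at h
  linarith

theorem sidon_pos {i j i' j' : ℕ} (hij : i < j) (h : (4 : ℤ) ^ j - 4 ^ i = 4 ^ j' - 4 ^ i') :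
    i = i' ∧ j = j' := by
  have h1 : (4 : ℤ) ^ i < 4 ^ j := pow_lt_pow_right₀ (by norm_num) hij
  have h2 : i' < j' := by
    have : (4 : ℤ) ^ i' < 4 ^ j' := by linarith
    exact (pow_lt_pow_iff_right₀ (by norm_num)).1 this
  have hj : j = j' := le_antisymm (sidon_aux h2 h.symm) (sidon_aux hij h)
  subst hj
  refine ⟨?_, rfl⟩
  have : (4 : ℤ) ^ i = 4 ^ i' := by linarith
  exact (pow_right_inj₀ (by norm_num) (by norm_num)).1 this

theorem sidon {i j i' j' : ℕ} (hij : i ≠ j) (h : (4 : ℤ) ^ j - 4 ^ i = 4 ^ j' - 4 ^ i') :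
    i = i' ∧ j = j' := by
  rcases lt_or_gt_of_ne hij with h1 | h1
  · exact sidon_pos h1 h
  · have := sidon_pos (i' := j') (j' := i') h1 (by linarith)
    exact ⟨this.2, this.1⟩

theorem zpow_apply_add {X : Type*} [TopologicalSpace X] (f : X ≃ₜ X) (m n : ℤ) (x : X) :
    (f ^ m) ((f ^ n) x) = (f ^ (m + n)) x := by
  rw [zpow_add]; rfl

theorem sparse_sum {X : Type*} [TopologicalSpace X] (f : X ≃ₜ X) (K : Set X) (N : ℤ)
    (hN : ∀ n : ℤ, N ≤ |n| → ∀ y ∈ K, (f ^ n) y ∉ K) {ι : Type*} (S : Finset ι) (d : ι → ℤ)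
    (hd : ∀ i ∈ S, ∀ j ∈ S, i ≠ j → N ≤ |d i - d j|) (h : X → ℝ) (hh : ∀ x ∉ K, h x = 0) (B : ℝ)
    (hB : ∀ x, |h x| ≤ B) (e : ι → ℝ) (he : ∀ i, |e i| ≤ 1) (x : X) :
    |∑ i ∈ S, e i * h ((f ^ (d i)) x)| ≤ B := by
  have hB0 : 0 ≤ B := (abs_nonneg _).trans (hB x)
  by_cases hex : ∃ i ∈ S, (f ^ (d i)) x ∈ K
  · obtain ⟨i, hi, hiK⟩ := hex
    rw [Finset.sum_eq_single_of_mem i hi]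
    · rw [abs_mul]
      calc |e i| * |h ((f ^ (d i)) x)| ≤ 1 * B :=
            mul_le_mul (he i) (hB _) (abs_nonneg _) zero_le_one
        _ = B := one_mul B
    · intro j hj hji
      rw [hh, mul_zero]
      intro hjK
      refine hN (d j - d i) (hd j hj i hi hji) _ hiK ?_
      rw [zpow_apply_add]
      simpa using hjK
  · push Not at hex
    rw [Finset.sum_eq_zero]
    · simpa using hB0
    · intro i hi
      rw [hh _ (hex i hi), mul_zero]

/-- The Koopman operator of `f ^ n`. -/
noncomputable def koop {X : Type*} [TopologicalSpace X] [CompactSpace X] (f : X ≃ₜ X) (n : ℤ) :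
    C(X, ℝ) →L[ℝ] C(X, ℝ) :=
  LinearMap.mkContinuous
    { toFun := fun φ => φ.comp ((f ^ n : X ≃ₜ X) : C(X, X))
      map_add' := fun _ _ => rfl
      map_smul' := fun _ _ => rfl } 1 (fun φ => by
        rw [one_mul, ContinuousMap.norm_le _ (norm_nonneg _)]
        intro x
        exact φ.norm_coe_le_norm _)

theorem koop_apply {X : Type*} [TopologicalSpace X] [CompactSpace X] (f : X ≃ₜ X) (n : ℤ)
    (φ : C(X, ℝ)) (x : X) : koop f n φ x = φ ((f ^ n) x) := rfl

/-- Span of the differences of Koopman operators. -/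
noncomputable def koopDiff {X : Type*} [TopologicalSpace X] [CompactSpace X] (f : X ≃ₜ X) :
    Submodule ℝ (C(X, ℝ) →L[ℝ] C(X, ℝ)) :=
  Submodule.span ℝ (Set.range fun n : ℤ => koop f n - koop f 0)

theorem perturb {X : Type*} [TopologicalSpace X] [CompactSpace X] (f : X ≃ₜ X) (K : Set X) (N : ℕ)
    (hN : ∀ n : ℤ, (N : ℤ) ≤ |n| → ∀ y ∈ K, (f ^ n) y ∉ K) (Q : Set X)
    (hQ : ∀ x ∈ Q, ∀ n : ℤ, (f ^ n) x ∉ K) (a h : C(X, ℝ)) (ha : ∀ x ∉ K, a x = 0)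
    (hh : ∀ x ∉ K, h x = 0) (δ : ℝ) (hδ : 0 < δ) :
    ∃ ψ : C(X, ℝ), (∀ x ∈ Q, ψ x = 0) ∧ ‖ψ‖ ≤ δ ∧ ∃ P ∈ koopDiff f, ‖P (a + ψ) - h‖ ≤ δ := by
  classical
  obtain ⟨m, hm⟩ := exists_nat_gt ((‖a‖ + ‖h‖) / δ)
  have hm0 : (0 : ℝ) < m := lt_of_le_of_lt (by positivity) hm
  set s : ℝ := 1 / (2 * m) with hs
  have hs0 : 0 < s := by positivity
  have hs1 : s ≤ 1 := by
    have : (1 : ℝ) ≤ m := by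
      have : 0 < m := by exact_mod_cast hm0
      exact_mod_cast this
    rw [hs, div_le_one (by positivity)]
    linarith
  have hsd : s * (‖a‖ + ‖h‖) ≤ δ := by
    rw [div_lt_iff₀ hδ] at hm
    rw [hs, one_div, inv_mul_le_iff₀ (by positivity)]
    nlinarith
  set S : Finset ℕ := Finset.range ((2 * m) * (2 * m)) with hS
  have hcard : s * s * (S.card : ℝ) = 1 := by
    rw [hS, Finset.card_range, hs]
    push_cast
    field_simp
  set e : ℕ → ℝ := fun j => (-1) ^ j with he
  have he1 : ∀ j, |e j| ≤ 1 := fun j => by simp [he]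
  have hee : ∀ j, e j * e j = 1 := fun j => by
    simp only [he, ← mul_pow]; norm_num
  have hsum : ∑ j ∈ S, e j = 0 := by
    have : ∀ k : ℕ, ∑ j ∈ Finset.range (2 * k), (-1 : ℝ) ^ j = 0 := by
      intro k
      induction k with
      | zero => simp
      | succ k ih =>
        rw [mul_add, mul_one, Finset.sum_range_succ, Finset.sum_range_succ, ih, pow_succ]
        ring
    rw [hS, mul_assoc]
    exact this _
  set M : ℤ := (N : ℤ) + 1 with hM
  have hMpos : 0 < M := by omega
  set d : ℕ → ℤ := fun j => M * 4 ^ j with hdd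
  have hgap : ∀ u v : ℤ, u ≠ v → (N : ℤ) ≤ |M * u - M * v| := by
    intro u v huv
    rw [← mul_sub, abs_mul, abs_of_pos hMpos]
    have : 1 ≤ |u - v| := Int.one_le_abs (sub_ne_zero.2 huv)
    nlinarith
  have h4 : ∀ i j : ℕ, i ≠ j → (4 : ℤ) ^ i ≠ 4 ^ j := fun i j hij hc =>
    hij ((pow_right_inj₀ (by norm_num) (by norm_num)).1 hc)
  set ψ : C(X, ℝ) := s • ∑ j ∈ S, e j • koop f (d j) h with hψ
  have hψx : ∀ x, ψ x = s * ∑ j ∈ S, e j * h ((f ^ (d j)) x) := by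
    intro x
    simp [hψ, koop_apply]
  set P : C(X, ℝ) →L[ℝ] C(X, ℝ) := s • ∑ j ∈ S, e j • koop f (- d j) with hP
  have hPx : ∀ φ x, P φ x = s * ∑ j ∈ S, e j * φ ((f ^ (- d j)) x) := by
    intro φ x
    simp [hP, koop_apply]
  have hnh : ∀ x, |h x| ≤ ‖h‖ := fun x => h.norm_coe_le_norm x
  have hna : ∀ x, |a x| ≤ ‖a‖ := fun x => a.norm_coe_le_norm x
  refine ⟨ψ, ?_, ?_, P, ?_, ?_⟩
  · intro x hx
    rw [hψx, Finset.sum_eq_zero, mul_zero]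
    intro j _
    rw [hh _ (hQ x hx _), mul_zero]
  · rw [ContinuousMap.norm_le _ hδ.le]
    intro x
    rw [hψx, Real.norm_eq_abs, abs_mul, abs_of_pos hs0]
    have := sparse_sum f K N hN S d (fun i _ j _ hij => hgap _ _ (h4 i j hij)) h hh ‖h‖ hnh e he1 x
    refine le_trans (mul_le_mul_of_nonneg_left this hs0.le) (le_trans ?_ hsd)
    exact mul_le_mul_of_nonneg_left (by linarith [norm_nonneg a]) hs0.le
  · have : P = s • ∑ j ∈ S, e j • (koop f (- d j) - koop f 0) := by
      simp only [smul_sub, Finset.sum_sub_distrib]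
      rw [← Finset.sum_smul, hsum, zero_smul, smul_zero, sub_zero]
    rw [this]
    exact Submodule.smul_mem _ _ (Submodule.sum_mem _ fun j _ =>
      Submodule.smul_mem _ _ (Submodule.subset_span ⟨_, rfl⟩))
  · rw [ContinuousMap.norm_le _ hδ.le]
    intro x
    have hPa : |P a x| ≤ s * ‖a‖ := by
      rw [hPx, abs_mul, abs_of_pos hs0]
      refine mul_le_mul_of_nonneg_left ?_ hs0.le
      refine sparse_sum f K N hN S (fun j => - d j) (fun i _ j _ hij => ?_) a ha ‖a‖ hna e he1 x
      have := hgap _ _ (h4 j i hij.symm)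
      simp only [hdd]
      rwa [neg_sub_neg]
    have hPψ : P ψ x - h x = s * s * ∑ q ∈ S.offDiag, (e q.1 * e q.2) *
        h ((f ^ (d q.2 - d q.1)) x) := by
      have h1 : P ψ x = s * s * ∑ q ∈ S ×ˢ S, (e q.1 * e q.2) * h ((f ^ (d q.2 - d q.1)) x) := by
        rw [hPx, Finset.sum_product, mul_assoc]
        congr 1
        rw [Finset.mul_sum]
        refine Finset.sum_congr rfl fun i _ => ?_
        rw [hψx, Finset.mul_sum, Finset.mul_sum, Finset.mul_sum]
        refine Finset.sum_congr rfl fun j _ => ?_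
        rw [zpow_apply_add, ← sub_eq_add_neg]
        ring
      rw [h1, ← Finset.diag_union_offDiag, Finset.sum_union (Finset.disjoint_diag_offDiag _),
        Finset.sum_diag]
      have h2 : ∑ i ∈ S, e i * e i * h ((f ^ (d i - d i)) x) = S.card * h x := by
        rw [← nsmul_eq_mul, ← Finset.sum_const]
        refine Finset.sum_congr rfl fun i _ => ?_
        rw [hee, sub_self, zpow_zero, one_mul]; rfl
      rw [h2, mul_add, ← mul_assoc, hcard]
      ring
    have hPψ' : |P ψ x - h x| ≤ s * ‖h‖ := by
      rw [hPψ, abs_mul, abs_of_pos (mul_pos hs0 hs0)]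
      have := sparse_sum f K N hN S.offDiag (fun q => d q.2 - d q.1) (fun q hq r hr hqr => by
        rw [Finset.mem_offDiag] at hq hr
        simp only [hdd, ← mul_sub]
        rw [mul_sub]
        refine hgap _ _ fun hc => hqr ?_
        obtain ⟨h1, h2⟩ := sidon hq.2.2 hc
        exact Prod.ext h1 h2) h hh ‖h‖ hnh (fun q => e q.1 * e q.2) (fun q => by
          rw [abs_mul]
          exact mul_le_one₀ (he1 _) (abs_nonneg _) (he1 _)) x
      calc s * s * _ ≤ s * s * ‖h‖ := mul_le_mul_of_nonneg_left this (mul_pos hs0 hs0).le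
        _ ≤ s * ‖h‖ := by
          refine mul_le_mul_of_nonneg_right ?_ (norm_nonneg _)
          nlinarith
    rw [map_add]
    have : (P a + P ψ - h) x = P a x + (P ψ x - h x) := by
      simp; ring
    rw [this, Real.norm_eq_abs]
    refine (abs_add_le _ _).trans ?_
    linarith

theorem soft_threshold {X : Type*} [TopologicalSpace X] [CompactSpace X] (φ : C(X, ℝ)) (ε : ℝ)
    (hε : 0 < ε) : ∃ ψ : C(X, ℝ), ‖φ - ψ‖ ≤ ε ∧ ∀ x, |φ x| < ε → ψ x = 0 := by
  refine ⟨⟨fun x => max (φ x - ε) 0 + min (φ x + ε) 0, by fun_prop⟩, ?_, ?_⟩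
  · rw [ContinuousMap.norm_le _ hε.le]
    intro x
    simp only [ContinuousMap.sub_apply, ContinuousMap.coe_mk, Real.norm_eq_abs]
    rw [abs_le]
    rcases max_cases (φ x - ε) 0 with h | h <;> rcases min_cases (φ x + ε) 0 with h' | h' <;>
      constructor <;> linarith
  · intro x hx
    rw [abs_lt] at hx
    simp only [ContinuousMap.coe_mk]
    rw [max_eq_right (by linarith), min_eq_right (by linarith), add_zero]

theorem exists_cyclic {X : Type*} [MetricSpace X] [CompactSpace X] (f : X ≃ₜ X) (Q : Set X)
    (hQ : ∀ x ∈ Q, ∀ n : ℤ, (f ^ n) x ∈ Q)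
    (hw : ∀ K : Set X, IsCompact K → Disjoint K Q →
      ∃ N : ℕ, ∀ n : ℤ, (N : ℤ) ≤ |n| → ∀ y ∈ K, (f ^ n) y ∉ K) :
    ∃ ψ : C(X, ℝ), (∀ x ∈ Q, ψ x = 0) ∧ ∀ h : C(X, ℝ), (∀ x ∈ Q, h x = 0) →
      ∀ ε > 0, ∃ P ∈ koopDiff f, ‖P ψ - h‖ < ε := by
  classical
  let E : Submodule ℝ C(X, ℝ) :=
    { carrier := {φ | ∀ x ∈ Q, φ x = 0}
      add_mem' := fun {a b} ha hb x hx => by simp [ha x hx, hb x hx]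
      zero_mem' := fun x _ => rfl
      smul_mem' := fun c a ha x hx => by simp [ha x hx] }
  have hEmem : ∀ φ, φ ∈ E ↔ ∀ x ∈ Q, φ x = 0 := fun φ => Iff.rfl
  have hEc : IsClosed (E : Set C(X, ℝ)) := by
    have : (E : Set C(X, ℝ)) = ⋂ x ∈ Q, {φ : C(X, ℝ) | φ x = 0} := by
      ext φ; simp [hEmem]
    rw [this]
    exact isClosed_biInter fun x _ => isClosed_eq (continuous_eval_const x)
      continuous_const
  have : CompleteSpace E := hEc.completeSpace_coe
  have : TopologicalSpace.SeparableSpace E := inferInstance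
  let O : ℕ × ℕ → Set E := fun q =>
    {ψ | ∃ P ∈ koopDiff f,
      ‖P (ψ : C(X, ℝ)) - (TopologicalSpace.denseSeq E q.1 : C(X, ℝ))‖ < 1 / ((q.2 : ℝ) + 1)}
  have hO : ∀ q, IsOpen (O q) := by
    intro q
    have : O q = ⋃ P ∈ koopDiff f, {ψ : E |
      ‖P (ψ : C(X, ℝ)) - (TopologicalSpace.denseSeq E q.1 : C(X, ℝ))‖ < 1 / ((q.2 : ℝ) + 1)} := by
      ext ψ; simp [O]
    rw [this]
    refine isOpen_biUnion fun P _ => isOpen_lt ?_ continuous_const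
    exact ((P.continuous.comp continuous_subtype_val).sub continuous_const).norm
  have hD : ∀ q, Dense (O q) := by
    intro q
    rw [Metric.dense_iff]
    intro ψ₀ r hr
    set h : C(X, ℝ) := (TopologicalSpace.denseSeq E q.1 : C(X, ℝ)) with hhdef
    have hhE : h ∈ E := (TopologicalSpace.denseSeq E q.1).2
    set η : ℝ := 1 / ((q.2 : ℝ) + 1)
    have hη : 0 < η := by positivity
    set δ : ℝ := min r η / 3
    have hδ : 0 < δ := by positivity
    have hδr : 3 * δ ≤ r := by
      have := min_le_left r η
      simp only [δ]; linarith
    have hδη : 3 * δ ≤ η := by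
      have := min_le_right r η
      simp only [δ]; linarith
    obtain ⟨a, ha1, ha2⟩ := soft_threshold (ψ₀ : C(X, ℝ)) δ hδ
    obtain ⟨h', hh1, hh2⟩ := soft_threshold h δ hδ
    set K : Set X := {x | δ ≤ |(ψ₀ : C(X, ℝ)) x|} ∪ {x | δ ≤ |h x|}
    have hKc : IsCompact K := by
      refine IsClosed.isCompact ?_
      exact (isClosed_le continuous_const (by fun_prop)).union
        (isClosed_le continuous_const (by fun_prop))
    have hKQ : ∀ x ∈ Q, x ∉ K := by
      intro x hx hxK
      have e1 := ψ₀.2 x hx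
      have e2 := hhE x hx
      rcases hxK with hxK | hxK
      · simp only [Set.mem_ofPred_eq, e1, abs_zero] at hxK
        linarith
      · simp only [Set.mem_ofPred_eq, e2, abs_zero] at hxK
        linarith
    obtain ⟨N, hN⟩ := hw K hKc (Set.disjoint_left.2 fun x hxK hx => hKQ x hx hxK)
    have ha' : ∀ x ∉ K, a x = 0 := fun x hx => ha2 x (not_le.1 fun hc => hx (Or.inl hc))
    have hh' : ∀ x ∉ K, h' x = 0 := fun x hx => hh2 x (not_le.1 fun hc => hx (Or.inr hc))
    obtain ⟨ψ, hψQ, hψn, P, hP, hPn⟩ := perturb f K N hN Q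
      (fun x hx n => hKQ _ (hQ x hx n)) a h' ha' hh' δ hδ
    have hmem : a + ψ ∈ E := E.add_mem (fun x hx => ha' x (hKQ x hx)) hψQ
    refine ⟨⟨a + ψ, hmem⟩, ?_, P, hP, ?_⟩
    · rw [Metric.mem_ball, dist_eq_norm]
      change ‖a + ψ - (ψ₀ : C(X, ℝ))‖ < r
      have : a + ψ - (ψ₀ : C(X, ℝ)) = ψ - ((ψ₀ : C(X, ℝ)) - a) := by abel
      rw [this]
      have := norm_sub_le ψ ((ψ₀ : C(X, ℝ)) - a)
      linarith
    · change ‖P (a + ψ) - h‖ < η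
      have : P (a + ψ) - h = (P (a + ψ) - h') - (h - h') := by abel
      rw [this]
      have := norm_sub_le (P (a + ψ) - h') (h - h')
      linarith
  obtain ⟨ψ, hψ⟩ := (dense_iInter_of_isOpen hO hD).nonempty
  rw [Set.mem_iInter] at hψ
  refine ⟨ψ, ψ.2, fun h hh ε hε => ?_⟩
  obtain ⟨k, hk⟩ := (TopologicalSpace.denseRange_denseSeq E).exists_dist_lt ⟨h, hh⟩ (half_pos hε)
  obtain ⟨n, hn⟩ := exists_nat_one_div_lt (half_pos hε)
  obtain ⟨P, hP, hPn⟩ := hψ (k, n)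
  refine ⟨P, hP, ?_⟩
  rw [dist_eq_norm] at hk
  change ‖h - (TopologicalSpace.denseSeq E k : C(X, ℝ))‖ < ε / 2 at hk
  simp only at hPn
  have : P (ψ : C(X, ℝ)) - h = (P (ψ : C(X, ℝ)) - (TopologicalSpace.denseSeq E k : C(X, ℝ)))
    - (h - (TopologicalSpace.denseSeq E k : C(X, ℝ))) := by abel
  rw [this]
  have := norm_sub_le (P (ψ : C(X, ℝ)) - (TopologicalSpace.denseSeq E k : C(X, ℝ)))
    (h - (TopologicalSpace.denseSeq E k : C(X, ℝ)))
  linarith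

/-- The invariant measure on a periodic orbit of period dividing two. -/
noncomputable def orbMeas (f : ↥unitInterval ≃ₜ ↥unitInterval) (q : unitInterval) :
    Measure ↥unitInterval :=
  (2⁻¹ : ENNReal) • (Measure.dirac q + Measure.dirac (f q))

theorem orbMeas_prob (f : ↥unitInterval ≃ₜ ↥unitInterval) (q : unitInterval) :
    IsProbabilityMeasure (orbMeas f q) := by
  constructor
  simp only [orbMeas, Measure.smul_apply, Measure.add_apply, measure_univ, smul_eq_mul]
  rw [one_add_one_eq_two]
  exact ENNReal.inv_mul_cancel (by norm_num) (by norm_num)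

theorem orbMeas_ergodic (f : ↥unitInterval ≃ₜ ↥unitInterval) (q : unitInterval)
    (hq : f (f q) = q) : Ergodic (⇑f) (orbMeas f q) := by
  have hm : Measurable f := f.continuous.measurable
  refine ⟨⟨hm, ?_⟩, ⟨fun s hs hfs => ?_⟩⟩
  · rw [orbMeas, Measure.map_smul, Measure.map_add _ _ hm, Measure.map_dirac' hm,
      Measure.map_dirac' hm, hq, add_comm]
  · have hiff : f q ∈ s ↔ q ∈ s := by
      conv_rhs => rw [← hfs]
      rfl
    rw [Filter.eventuallyConst_set]
    have h2 : (2⁻¹ : ENNReal) ≠ 0 := by simp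
    by_cases h : q ∈ s
    · left
      rw [orbMeas, Measure.ae_ennreal_smul_measure_iff h2, ae_add_measure_iff]
      exact ⟨(ae_dirac_iff (p := fun x => x ∈ s) hs).2 h,
        (ae_dirac_iff (p := fun x => x ∈ s) hs).2 (hiff.2 h)⟩
    · right
      change ∀ᵐ x ∂(orbMeas f q), x ∉ s
      rw [orbMeas, Measure.ae_ennreal_smul_measure_iff h2, ae_add_measure_iff]
      exact ⟨(ae_dirac_iff (p := fun x => x ∉ s) hs.compl).2 h,
        (ae_dirac_iff (p := fun x => x ∉ s) hs.compl).2 fun hc => h (hiff.1 hc)⟩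

theorem orbMeas_eq (f : ↥unitInterval ≃ₜ ↥unitInterval) (q r : unitInterval)
    (h : orbMeas f q = orbMeas f r) : q = r ∨ q = f r := by
  by_contra hc
  push Not at hc
  have h1 := congrArg (fun m => m {q}) h
  simp [orbMeas, Measure.smul_apply, Measure.add_apply, hc.1.symm, hc.2.symm] at h1

theorem topMult_le (f : ↥unitInterval ≃ₜ ↥unitInterval) :
    topMult f
      ≤ {μ : Measure ↥unitInterval | IsProbabilityMeasure μ ∧ Ergodic (⇑f) μ}.encard := by
  classical
  set S := {μ : Measure ↥unitInterval | IsProbabilityMeasure μ ∧ Ergodic (⇑f) μ} with hSdef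
  by_cases hfin : S.Finite
  swap
  · rw [Set.encard_eq_top (by exact hfin)]; exact le_top
  set Q : Set unitInterval := {x | f (f x) = x} with hQdef
  have hQmem : ∀ x, x ∈ Q ↔ f (f x) = x := fun x => Iff.rfl
  have hQf : ∀ x ∈ Q, f x ∈ Q := fun x hx => congrArg f hx
  have hQsymm : ∀ x ∈ Q, f.symm x ∈ Q := fun x hx => by
    rw [hQmem] at hx ⊢
    rw [f.apply_symm_apply, ← hx, f.symm_apply_apply, hx]
  have hQinv : ∀ x ∈ Q, ∀ n : ℤ, (f ^ n) x ∈ Q := by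
    intro x hx n
    induction n using Int.induction_on with
    | zero => exact hx
    | succ n ih => rw [add_comm, zpow_one_add]; exact hQf _ ih
    | pred n ih => rw [sub_eq_add_neg, add_comm, zpow_add, zpow_neg_one]; exact hQsymm _ ih
  obtain ⟨ψ, hψQ, hψ⟩ := exists_cyclic f Q hQinv (fun K hK hKQ =>
    wander_interval f K hK fun x hx hc => Set.disjoint_left.1 hKQ hx hc)
  -- a fixed point
  obtain ⟨c, hc⟩ : ∃ c, f c = c := by
    obtain ⟨c, -, hc⟩ := exists_mem_Icc_isFixedPt (a := (0 : unitInterval)) (b := 1) (f := f)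
      f.continuous.continuousOn zero_le_one unitInterval.nonneg' unitInterval.le_one'
    exact ⟨c, hc⟩
  have hcQ : c ∈ Q := by rw [hQmem, hc, hc]
  -- finiteness
  have hmS : orbMeas f '' Q ⊆ S := by
    rintro _ ⟨q, hq, rfl⟩
    exact ⟨orbMeas_prob f q, orbMeas_ergodic f q hq⟩
  have hIfin : (orbMeas f '' Q).Finite := hfin.subset hmS
  have hQfin : Q.Finite := by
    refine Set.Finite.of_finite_fibers (orbMeas f) hIfin ?_
    rintro _ ⟨r, hr, rfl⟩
    refine Set.Finite.subset (Set.toFinite {r, f r}) ?_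
    rintro q ⟨hq, hqr⟩
    rcases orbMeas_eq f q r hqr with h | h
    · exact Or.inl h
    · exact Or.inr h
  -- bump functions
  have hbump : ∀ q : unitInterval, ∃ e : C(unitInterval, ℝ), e q = 1 ∧
      ∀ x ∈ Q, x ≠ q → e x = 0 := by
    intro q
    obtain ⟨e, h0, h1, -⟩ := exists_continuous_zero_one_of_isClosed
      (s := Q \ {q}) (t := {q}) (hQfin.subset Set.diff_subset).isClosed isClosed_singleton
      Set.disjoint_sdiff_left
    exact ⟨e, h1 rfl, fun x hx hxq => h0 ⟨hx, hxq⟩⟩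
  choose e he1 he0 using hbump
  -- representatives
  have hrep : ∀ μ : Measure unitInterval, ∃ r, μ ∈ orbMeas f '' Q → r ∈ Q ∧ orbMeas f r = μ := by
    intro μ
    by_cases h : μ ∈ orbMeas f '' Q
    · obtain ⟨r, hr⟩ := h
      exact ⟨r, fun _ => hr⟩
    · exact ⟨c, fun h' => absurd h' h⟩
  choose r hr using hrep
  let I : Finset (Measure unitInterval) := hIfin.toFinset
  have hcI : orbMeas f c ∈ I := hIfin.mem_toFinset.2 ⟨c, hcQ, rfl⟩
  let F : Finset C(unitInterval, ℝ) :=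
    insert (1 + ψ) ((I.erase (orbMeas f c)).image fun μ => e (r μ))
  have hFcard : F.card ≤ I.card := by
    have h1 := Finset.card_insert_le (1 + ψ) ((I.erase (orbMeas f c)).image fun μ => e (r μ))
    have h2 := Finset.card_image_le (s := I.erase (orbMeas f c)) (f := fun μ => e (r μ))
    have h3 := Finset.card_erase_add_one hcI
    change (insert (1 + ψ) ((I.erase (orbMeas f c)).image fun μ => e (r μ))).card ≤ _
    omega
  have hIS : (I.card : ℕ∞) ≤ S.encard := by
    rw [← Set.encard_coe_eq_coe_finsetCard]
    refine Set.encard_le_encard ?_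
    rw [hIfin.coe_toFinset]
    exact hmS
  refine le_trans (sInf_le ⟨F, rfl, ?_⟩) (le_trans (by exact_mod_cast hFcard) hIS)
  -- density
  set V : Submodule ℝ C(unitInterval, ℝ) :=
    (Submodule.span ℝ (iterSet f (F : Set C(unitInterval, ℝ)))).topologicalClosure with hV
  have hVit : ∀ φ ∈ F, ∀ n : ℤ, koop f n φ ∈ V := by
    intro φ hφ n
    refine Submodule.le_topologicalClosure _ (Submodule.subset_span ⟨φ, hφ, n, ?_⟩)
    rw [hiter_eq]
    rfl
  have hone : ∀ n : ℤ, koop f n 1 = 1 := fun n => by ext x; rfl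
  have hPone : ∀ P ∈ koopDiff f, P 1 = 0 ∧ ∀ φ ∈ F, P φ ∈ V := by
    intro P hP
    induction hP using Submodule.span_induction with
    | mem P hP =>
      obtain ⟨n, rfl⟩ := hP
      refine ⟨?_, fun φ hφ => ?_⟩
      · rw [ContinuousLinearMap.sub_apply, hone, hone, sub_self]
      · exact V.sub_mem (hVit φ hφ n) (hVit φ hφ 0)
    | zero => exact ⟨rfl, fun φ _ => V.zero_mem⟩
    | add A B _ _ hA hB =>
      refine ⟨?_, fun φ hφ => V.add_mem (hA.2 φ hφ) (hB.2 φ hφ)⟩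
      rw [ContinuousLinearMap.add_apply, hA.1, hB.1, add_zero]
    | smul a A _ hA =>
      refine ⟨?_, fun φ hφ => V.smul_mem a (hA.2 φ hφ)⟩
      rw [ContinuousLinearMap.smul_apply, hA.1, smul_zero]
  have hVc : IsClosed (V : Set C(unitInterval, ℝ)) := Submodule.isClosed_topologicalClosure _
  have hψF : 1 + ψ ∈ F := Finset.mem_insert_self _ _
  have hEV : ∀ h : C(unitInterval, ℝ), (∀ x ∈ Q, h x = 0) → h ∈ V := by
    intro h hh
    have : h ∈ closure (V : Set C(unitInterval, ℝ)) := by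
      rw [Metric.mem_closure_iff]
      intro ε hε
      obtain ⟨P, hP, hPn⟩ := hψ h hh ε hε
      refine ⟨P ψ, ?_, ?_⟩
      · have h1 := (hPone P hP).2 _ hψF
        rwa [map_add, (hPone P hP).1, zero_add] at h1
      · rwa [dist_comm, dist_eq_norm]
    rwa [hVc.closure_eq] at this
  have h1V : (1 : C(unitInterval, ℝ)) ∈ V := by
    have h1 := V.sub_mem (hVit _ hψF 0) (hEV ψ hψQ)
    have h2 : koop f 0 (1 + ψ) = 1 + ψ := by ext x; rfl
    rwa [h2, add_sub_cancel_right] at h1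
  have hdelta : ∀ q ∈ Q, q ≠ c → ∃ δ ∈ V, δ q = 1 ∧ ∀ x ∈ Q, x ≠ q → δ x = 0 := by
    intro q hq hqc
    have hμI : orbMeas f q ∈ orbMeas f '' Q := ⟨q, hq, rfl⟩
    obtain ⟨hrQ, hreq⟩ := hr _ hμI
    have hne : orbMeas f q ≠ orbMeas f c := by
      intro heq
      rcases orbMeas_eq f q c heq with h | h
      · exact hqc h
      · exact hqc (h.trans hc)
    have hmem : e (r (orbMeas f q)) ∈ F := by
      refine Finset.mem_insert_of_mem (Finset.mem_image_of_mem (fun μ => e (r μ)) ?_)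
      exact Finset.mem_erase.2 ⟨hne, hIfin.mem_toFinset.2 hμI⟩
    rcases orbMeas_eq f q _ hreq.symm with h | h
    · refine ⟨_, hVit _ hmem 0, ?_, ?_⟩
      · rw [← h]; exact he1 q
      · intro x hx hxq
        rw [← h]; exact he0 q x hx hxq
    · have hfq : f q = r (orbMeas f q) := by
        have h' := congrArg f h
        rw [(hQmem _).1 hrQ] at h'
        exact h'
      refine ⟨_, hVit _ hmem 1, ?_, ?_⟩
      · rw [koop_apply, zpow_one, hfq]; exact he1 _
      · intro x hx hxq
        rw [koop_apply, zpow_one]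
        refine he0 _ _ (hQf x hx) fun hcon => hxq (f.injective ?_)
        rw [hcon, hfq]
  choose! δ hδV hδ1 hδ0 using hdelta
  rw [dense_iff_closure_eq, Set.eq_univ_iff_forall]
  intro g
  change g ∈ V
  let Qc : Finset unitInterval := hQfin.toFinset.erase c
  have hQc : ∀ q ∈ Qc, q ∈ Q ∧ q ≠ c := fun q hq =>
    ⟨hQfin.mem_toFinset.1 (Finset.mem_erase.1 hq).2, (Finset.mem_erase.1 hq).1⟩
  let k : C(unitInterval, ℝ) := g c • (1 : C(unitInterval, ℝ)) + ∑ q ∈ Qc, (g q - g c) • δ q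
  have hkV : k ∈ V := V.add_mem (V.smul_mem _ h1V)
    (V.sum_mem fun q hq => V.smul_mem _ (hδV q (hQc q hq).1 (hQc q hq).2))
  have hkx : ∀ x, k x = g c + ∑ q ∈ Qc, (g q - g c) * δ q x := by
    intro x
    simp [k]
  have hgk : g - k ∈ V := by
    refine hEV _ fun x hx => ?_
    rw [ContinuousMap.sub_apply, hkx]
    by_cases hxc : x = c
    · subst hxc
      rw [Finset.sum_eq_zero]
      · ring
      · intro q hq
        rw [hδ0 q (hQc q hq).1 (hQc q hq).2 x hx (hQc q hq).2.symm, mul_zero]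
    · rw [Finset.sum_eq_single_of_mem x
        (Finset.mem_erase.2 ⟨hxc, hQfin.mem_toFinset.2 hx⟩), hδ1 x hx hxc]
      · ring
      · intro q hq hqx
        rw [hδ0 q (hQc q hq).1 (hQc q hq).2 x hx hqx.symm, mul_zero]
  have := V.add_mem hgk hkV
  rwa [sub_add_cancel] at this

/-- **Multiplicity of interval homeomorphisms.**  For any homeomorphism `f` of `[0,1]`,
the topological multiplicity of `f` equals the number of ergodic `f`-invariant Borel
probability measures on `[0,1]` (equality in `ℕ ∪ {∞}`). -/
theorem topMult_interval_homeo_eq_encard_ergodic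
    (f : ↥unitInterval ≃ₜ ↥unitInterval) :
    topMult f
      = {μ : Measure ↥unitInterval | IsProbabilityMeasure μ ∧ Ergodic (⇑f) μ}.encard := by
  exact le_antisymm (topMult_le f) (encard_le_topMult f)
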